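/- Let (X,f) be a topological dynamical system with X having at least two points. If (X,f) is multi-transitive, then (X,f) is Li-Yorke chaotic, i.e., there exists an uncountable subset C of X such that every pair of distinct points x, y ∈ C satisfies limsup_{n→∞} d(f^n(x), f^n(y)) > 0 and liminf_{n→∞} d(f^n(x), f^n(y)) = 0. -/

import Mathlib

open Function Set Filter Topology MeasureTheory

/-- A topological dynamical system `f : X → X` is (topologically) transitive if for every
two non-empty open subsets `U`, `V` there exists `n ≥ 1` with `f^[n] '' U ∩ V ≠ ∅`. -/
def IsTopTransitive {X : Type*} [TopologicalSpace X] (f : X → X) : Prop :=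
  ∀ U V : Set X, IsOpen U → IsOpen V → U.Nonempty → V.Nonempty →
    ∃ n : ℕ, 1 ≤ n ∧ (f^[n] '' U ∩ V).Nonempty

/-- Multi-transitivity with respect to a vector `a = (a₁, …, a_r)`: the product system
`(X^r, f^{a₁} × ⋯ × f^{a_r})` is transitive. -/
def MultiTransWrt {X : Type*} [TopologicalSpace X] (f : X → X) {r : ℕ} (a : Fin r → ℕ) : Prop :=
  IsTopTransitive (fun x : Fin r → X => fun i => f^[a i] (x i))

/-- `(X, f)` is multi-transitive if it is multi-transitive with respect to `(1, 2, …, n)`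
for every `n ≥ 1`. -/
def MultiTrans {X : Type*} [TopologicalSpace X] (f : X → X) : Prop :=
  ∀ n : ℕ, 1 ≤ n → MultiTransWrt f (fun i : Fin n => (i : ℕ) + 1)

/-- `(X, f)` is strongly multi-transitive if it is multi-transitive with respect to every
vector of positive integers. -/
def StrongMultiTrans {X : Type*} [TopologicalSpace X] (f : X → X) : Prop :=
  ∀ r : ℕ, 1 ≤ r → ∀ a : Fin r → ℕ, (∀ i, 1 ≤ a i) → MultiTransWrt f a

/-- The hitting time set `N(U, V) = {n ≥ 1 : f^[n] '' U ∩ V ≠ ∅}`. -/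
def HittingTimes {X : Type*} [TopologicalSpace X] (f : X → X) (U V : Set X) : Set ℕ :=
  {n : ℕ | 1 ≤ n ∧ (f^[n] '' U ∩ V).Nonempty}

lemma mycielski_aux {X : Type*} [TopologicalSpace X] [SecondCountableTopology X] [BaireSpace X]
    [Nonempty X] (D : ℕ → Set (X × X)) (ho : ∀ i, IsOpen (D i)) (hd : ∀ i, Dense (D i))
    (hsym : ∀ i x y, (x, y) ∈ D i → (y, x) ∈ D i) (hirr : ∀ x, ∃ i, (x, x) ∉ D i) :
    ∃ C : Set X, ¬ C.Countable ∧ ∀ x ∈ C, ∀ y ∈ C, x ≠ y → ∀ i, (x, y) ∈ D i := by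
  classical
  let B := TopologicalSpace.countableBasis X
  have hB : TopologicalSpace.IsTopologicalBasis B := TopologicalSpace.isBasis_countableBasis X
  have hBc : B.Countable := TopologicalSpace.countable_countableBasis X
  have : Countable B := hBc.to_subtype
  let E : ℕ × B → Set X := fun p => Prod.fst '' (D p.1 ∩ (univ ×ˢ p.2.1))
  have hEo : ∀ p, IsOpen (E p) := fun p =>
    isOpenMap_fst _ ((ho p.1).inter (isOpen_univ.prod (hB.isOpen p.2.2)))
  have hEd : ∀ p, Dense (E p) := by
    rintro ⟨i, b, hb⟩
    rw [dense_iff_inter_open]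
    intro U hU hUn
    have hbn : b.Nonempty := TopologicalSpace.nonempty_of_mem_countableBasis hb
    obtain ⟨⟨x, y⟩, hxy, hD⟩ := (hd i).inter_open_nonempty (U ×ˢ b) (hU.prod (hB.isOpen hb))
      (hUn.prod hbn)
    exact ⟨x, hxy.1, (x, y), ⟨hD, mem_univ _, hxy.2⟩, rfl⟩
  let X0 : Set X := ⋂ p, E p
  have hsec : ∀ x ∈ X0, ∀ i, Dense {y | (x, y) ∈ D i} := by
    intro x hx i
    rw [hB.dense_iff]
    intro b hb hbn
    obtain ⟨⟨x', y⟩, ⟨h1, h2⟩, rfl⟩ := mem_iInter.1 hx (i, ⟨b, hb⟩)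
    exact ⟨y, h2.2, h1⟩
  let S : Set (Set X) := {C | C ⊆ X0 ∧ C.Pairwise fun x y => ∀ i, (x, y) ∈ D i}
  obtain ⟨C, hC⟩ : ∃ C, Maximal (· ∈ S) C := by
    apply zorn_subset
    intro c hc hch
    refine ⟨⋃₀ c, ⟨sUnion_subset fun s hs => (hc hs).1, ?_⟩, fun s hs => subset_sUnion_of_mem hs⟩
    rw [pairwise_sUnion hch.directedOn]
    exact fun s hs => (hc hs).2
  refine ⟨C, ?_, fun x hx y hy hxy => hC.prop.2 hx hy hxy⟩
  intro hcount
  have : Countable C := hcount.to_subtype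
  let F : (ℕ × B) ⊕ (ℕ × C) → Set X := Sum.elim E fun p => {y | (p.2.1, y) ∈ D p.1}
  have hF : Dense (⋂ j, F j) := by
    apply dense_iInter_of_isOpen
    · rintro (p | ⟨i, x, hx⟩)
      · exact hEo p
      · exact (ho i).preimage (by fun_prop : Continuous fun y : X => (x, y))
    · rintro (p | ⟨i, x, hx⟩)
      · exact hEd p
      · exact hsec x (hC.prop.1 hx) i
  obtain ⟨y, hy⟩ := hF.nonempty
  rw [mem_iInter] at hy
  have hyC : ∀ x ∈ C, ∀ i, (x, y) ∈ D i := fun x hx i => hy (Sum.inr (i, ⟨x, hx⟩))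
  have hmem : insert y C ∈ S := by
    refine ⟨insert_subset (mem_iInter.2 fun p => hy (Sum.inl p)) hC.prop.1, ?_⟩
    refine hC.prop.2.insert fun x hx _ => ⟨fun i => hsym _ _ _ (hyC x hx i), hyC x hx⟩
  have := hC.le_of_ge hmem (subset_insert y C) (mem_insert y C)
  obtain ⟨i, hi⟩ := hirr y
  exact hi (hyC y this i)

lemma multiTrans_hit {X : Type*} [TopologicalSpace X] {f : X → X} (hmt : MultiTrans f) (r : ℕ)
    (hr : 1 ≤ r) (U V : Fin r → Set X) (hU : ∀ i, IsOpen (U i)) (hV : ∀ i, IsOpen (V i))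
    (hUn : ∀ i, (U i).Nonempty) (hVn : ∀ i, (V i).Nonempty) :
    ∃ n, 1 ≤ n ∧ ∀ i : Fin r, ∃ x ∈ U i, f^[(i + 1) * n] x ∈ V i := by
  obtain ⟨n, hn, y, ⟨x, hx, hxy⟩, hy⟩ := hmt r hr (univ.pi U) (univ.pi V)
    (isOpen_set_pi finite_univ fun i _ => hU i) (isOpen_set_pi finite_univ fun i _ => hV i)
    (univ_pi_nonempty_iff.2 hUn) (univ_pi_nonempty_iff.2 hVn)
  have key : ∀ n, ∀ x : Fin r → X, ∀ i : Fin r,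
      (fun x : Fin r → X => fun i => f^[(i : ℕ) + 1] (x i))^[n] x i
        = f^[((i : ℕ) + 1) * n] (x i) := by
    intro n
    induction n with
    | zero => intro x i; simp
    | succ n ih =>
      intro x i
      rw [iterate_succ_apply, ih, ← iterate_add_apply]
      congr 1
  refine ⟨n, hn, fun i => ⟨x i, hx i (mem_univ i), ?_⟩⟩
  rw [← key, hxy]
  exact hy i (mem_univ i)

lemma multiTrans_hit_large {X : Type*} [TopologicalSpace X] {f : X → X} (hf : Continuous f)
    (hmt : MultiTrans f) (N : ℕ) (U V : Set X) (hU : IsOpen U) (hV : IsOpen V)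
    (hUn : U.Nonempty) (hVn : V.Nonempty) :
    ∃ n, N ≤ n ∧ ∃ x ∈ U, f^[n] x ∈ V := by
  induction N generalizing V with
  | zero =>
    obtain ⟨n, hn, h⟩ := multiTrans_hit hmt 1 le_rfl (fun _ => U) (fun _ => V)
      (fun _ => hU) (fun _ => hV) (fun _ => hUn) (fun _ => hVn)
    obtain ⟨x, hx, hxV⟩ := h 0
    exact ⟨n, Nat.zero_le _, x, hx, by simpa using hxV⟩
  | succ N ih =>
    have hne : (f ⁻¹' V).Nonempty := by
      obtain ⟨n, hn, h⟩ := multiTrans_hit hmt 1 le_rfl (fun _ => U) (fun _ => V)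
        (fun _ => hU) (fun _ => hV) (fun _ => hUn) (fun _ => hVn)
      obtain ⟨x, hx, hxV⟩ := h 0
      obtain ⟨k, rfl⟩ : ∃ k, n = k + 1 := ⟨n - 1, by omega⟩
      refine ⟨f^[k] x, ?_⟩
      rw [mem_preimage, ← iterate_succ_apply' f]
      simpa using hxV
    obtain ⟨n, hn, x, hx, hxV⟩ := ih (f ⁻¹' V) (hV.preimage hf) hne
    refine ⟨n + 1, by omega, x, hx, ?_⟩
    rw [iterate_succ_apply']
    exact hxV

lemma prox_dense {X : Type*} [MetricSpace X] [CompactSpace X] {f : X → X} (hf : Continuous f)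
    (hmt : MultiTrans f) (N : ℕ) (ε : ℝ) (hε : 0 < ε) :
    Dense {p : X × X | ∃ n ≥ N, dist (f^[n] p.1) (f^[n] p.2) < ε} := by
  rw [(TopologicalSpace.isTopologicalBasis_opens.prod
    TopologicalSpace.isTopologicalBasis_opens).dense_iff]
  rintro _ ⟨U, hU, V, hV, rfl⟩ ⟨⟨u, v⟩, hu, hv⟩
  obtain ⟨t, -, ht, hcov⟩ := (isCompact_univ (X := X)).finite_cover_balls (half_pos hε)
  have : Finite t := ht.to_subtype
  have : Fintype t := Fintype.ofFinite t
  obtain ⟨n, hn, h⟩ := multiTrans_hit hmt (Fintype.card t + 1) (by omega) (fun _ => U) (fun _ => V)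
      (fun _ => hU) (fun _ => hV) (fun _ => ⟨u, hu⟩) (fun _ => ⟨v, hv⟩)
  have hc : ∀ i : Fin (Fintype.card t + 1), ∃ c : t, f^[i * n] u ∈ Metric.ball c.1 (ε / 2) := by
    intro i
    have := hcov (mem_univ (f^[i * n] u))
    simp only [mem_iUnion] at this
    obtain ⟨c, hc, h⟩ := this
    exact ⟨⟨c, hc⟩, h⟩
  choose c hc using hc
  have hex : ∃ i j : Fin (Fintype.card t + 1), i < j ∧ c i = c j := by
    obtain ⟨i, j, hij, h⟩ := Fintype.exists_ne_map_eq_of_card_lt c (by simp)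
    rcases lt_or_gt_of_ne hij with h' | h'
    · exact ⟨i, j, h', h⟩
    · exact ⟨j, i, h', h.symm⟩
  obtain ⟨i, j, hij, hcc⟩ := hex
  obtain ⟨d, hd⟩ : ∃ d : ℕ, (j : ℕ) = i + (d + 1) := ⟨j - i - 1, by have := Fin.lt_def.1 hij; omega⟩
  obtain ⟨x, hx, hxV⟩ := h ⟨d, by have := j.2; omega⟩
  simp only at hxV
  set m := (d + 1) * n with hm
  have hfm := hf.iterate m
  obtain ⟨k, hk, y, ⟨hyU, hyV⟩, hy1, hy2⟩ := multiTrans_hit_large hf hmt N (U ∩ f^[m] ⁻¹' V)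
    (Metric.ball (c i).1 (ε / 2) ∩ f^[m] ⁻¹' Metric.ball (c i).1 (ε / 2))
    (IsOpen.inter hU (IsOpen.preimage hfm hV))
    (Metric.isOpen_ball.inter (Metric.isOpen_ball.preimage hfm)) ⟨x, hx, hxV⟩
    ⟨f^[i * n] u, hc i, by
      rw [mem_preimage, ← iterate_add_apply, hcc]
      have := hc j
      rwa [hd, show (i + (d + 1)) * n = m + i * n by rw [hm]; ring] at this⟩
  refine ⟨(y, f^[m] y), ⟨hyU, hyV⟩, k, hk, ?_⟩
  rw [mem_preimage, ← iterate_add_apply, add_comm, iterate_add_apply] at hy2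
  have := dist_triangle_right (f^[k] y) (f^[k] (f^[m] y)) (c i).1
  rw [Metric.mem_ball] at hy1 hy2
  simp only
  linarith

lemma sep_dense {X : Type*} [MetricSpace X] [CompactSpace X] {f : X → X} (hf : Continuous f)
    (hmt : MultiTrans f) (p q : X) (hpq : p ≠ q) (N : ℕ) :
    Dense {z : X × X | ∃ n ≥ N, dist p q / 32 < dist (f^[n] z.1) (f^[n] z.2)} := by
  have hD : 0 < dist p q := dist_pos.2 hpq
  rw [(TopologicalSpace.isTopologicalBasis_opens.prod
    TopologicalSpace.isTopologicalBasis_opens).dense_iff]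
  rintro _ ⟨U₀, hU₀, V, hV, rfl⟩ ⟨⟨u, v⟩, hu, hv⟩
  by_contra hcon
  have hcl : ∀ x ∈ U₀, ∀ n ≥ N, dist (f^[n] x) (f^[n] v) ≤ dist p q / 32 := by
    intro x hx n hn
    by_contra hlt
    exact hcon ⟨(x, v), ⟨hx, hv⟩, n, hn, not_le.1 hlt⟩
  obtain ⟨w, hw⟩ : ∃ w, dist p q / 2 ≤ dist u w := by
    by_contra! h
    have h1 := h p
    have h2 := h q
    have := dist_triangle_left p q u
    linarith
  set U := U₀ ∩ Metric.ball u (dist p q / 8) with hUdef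
  have hU : IsOpen U := IsOpen.inter hU₀ Metric.isOpen_ball
  have huU : u ∈ U := ⟨hu, Metric.mem_ball_self (by positivity)⟩
  set W := Metric.ball w (dist p q / 8) with hWdef
  have hW : IsOpen W := Metric.isOpen_ball
  have hwW : w ∈ W := Metric.mem_ball_self (by positivity)
  obtain ⟨n, hn, h⟩ := multiTrans_hit hmt 2 (by omega) (fun _ => U) ![U, W] (fun _ => hU)
    (by intro i; fin_cases i <;> assumption) (fun _ => ⟨u, huU⟩)
    (by intro i; fin_cases i; exacts [⟨u, huU⟩, ⟨w, hwW⟩])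
  obtain ⟨y, hy, hyU⟩ := h 0
  obtain ⟨z, hz, hzW⟩ := h 1
  have hyU : f^[n] y ∈ U := by simpa using hyU
  have hzW : f^[n + n] z ∈ W := by
    have h2 : f^[2 * n] z ∈ W := by simpa [one_add_one_eq_two] using hzW
    rwa [two_mul] at h2
  obtain ⟨m, hm, x, ⟨hx1, hx2⟩, hx3, hx4⟩ := multiTrans_hit_large hf hmt N (U ∩ f^[n] ⁻¹' U)
    (U ∩ f^[n + n] ⁻¹' W) (hU.inter (hU.preimage (hf.iterate n)))
    (hU.inter (hW.preimage (hf.iterate _))) ⟨y, hy, hyU⟩ ⟨z, hz, hzW⟩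
  have e1 := hcl _ hx1.1 m hm
  have e2 := hcl _ hx2.1 m hm
  have e3 := hcl _ hx1.1 (m + n) (by omega)
  have e4 := hcl _ hx2.1 (m + n) (by omega)
  rw [mem_preimage, ← iterate_add_apply] at hx4
  rw [← iterate_add_apply] at e2 e4
  rw [show n + n + m = m + n + n by ring] at hx4
  have t1 := dist_triangle_right (f^[m] x) (f^[m + n] x) (f^[m] v)
  have t2 := dist_triangle_right (f^[m + n] x) (f^[m + n + n] x) (f^[m + n] v)
  have t3 := dist_triangle (f^[m] x) (f^[m + n] x) (f^[m + n + n] x)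
  have t4 := dist_triangle4 u (f^[m] x) (f^[m + n + n] x) w
  have b1 := hx3.2
  rw [Metric.mem_ball, dist_comm] at b1
  rw [hWdef, Metric.mem_ball] at hx4
  linarith

theorem multiTrans_LiYorke_chaotic
    {X : Type*} [MetricSpace X] [CompactSpace X] [Nontrivial X]
    (f : X → X) (hf : Continuous f) (hmt : MultiTrans f) :
    ∃ C : Set X, ¬ C.Countable ∧
      ∀ x ∈ C, ∀ y ∈ C, x ≠ y →
        0 < Filter.limsup (fun n => dist (f^[n] x) (f^[n] y)) Filter.atTop ∧
        Filter.liminf (fun n => dist (f^[n] x) (f^[n] y)) Filter.atTop = 0 := by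
  obtain ⟨p, q, hpq⟩ := exists_pair_ne X
  have hD : 0 < dist p q := dist_pos.2 hpq
  let D₁ : ℕ → Set (X × X) := fun N =>
    {z | ∃ n ≥ N, dist (f^[n] z.1) (f^[n] z.2) < 1 / ((N : ℝ) + 1)}
  let D₂ : ℕ → Set (X × X) := fun N =>
    {z | ∃ n ≥ N, dist p q / 32 < dist (f^[n] z.1) (f^[n] z.2)}
  have hcont : ∀ n, Continuous fun z : X × X => dist (f^[n] z.1) (f^[n] z.2) := fun n =>
    ((hf.iterate n).comp continuous_fst).dist ((hf.iterate n).comp continuous_snd)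
  have ho₁ : ∀ N, IsOpen (D₁ N) := by
    intro N
    have : D₁ N = ⋃ n ≥ N, {z | dist (f^[n] z.1) (f^[n] z.2) < 1 / ((N : ℝ) + 1)} := by
      ext z; simp [D₁]
    rw [this]
    exact isOpen_biUnion fun n _ => isOpen_lt (hcont n) continuous_const
  have ho₂ : ∀ N, IsOpen (D₂ N) := by
    intro N
    have : D₂ N = ⋃ n ≥ N, {z | dist p q / 32 < dist (f^[n] z.1) (f^[n] z.2)} := by
      ext z; simp [D₂]
    rw [this]
    exact isOpen_biUnion fun n _ => isOpen_lt continuous_const (hcont n)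
  obtain ⟨C, hC, hCD⟩ := mycielski_aux (fun N => D₁ N ∩ D₂ N) (fun N => (ho₁ N).inter (ho₂ N))
    (fun N => (prox_dense hf hmt N _ (by positivity)).inter_of_isOpen_left
      (sep_dense hf hmt p q hpq N) (ho₁ N))
    (by
      rintro N x y ⟨⟨n, hn, h⟩, ⟨k, hk, h'⟩⟩
      exact ⟨⟨n, hn, by rwa [dist_comm]⟩, ⟨k, hk, h'.trans_eq (dist_comm _ _)⟩⟩)
    (by
      intro x
      refine ⟨0, ?_⟩
      rintro ⟨-, ⟨k, hk, h'⟩⟩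
      simp only [dist_self] at h'
      linarith)
  refine ⟨C, hC, fun x hx y hy hxy => ?_⟩
  have h := hCD x hx y hy hxy
  have hbd : IsBoundedUnder (· ≤ ·) atTop (fun n => dist (f^[n] x) (f^[n] y)) :=
    isBoundedUnder_of ⟨Metric.diam (univ : Set X), fun n =>
      Metric.dist_le_diam_of_mem isCompact_univ.isBounded (mem_univ _) (mem_univ _)⟩
  have hbd' : IsBoundedUnder (· ≥ ·) atTop (fun n => dist (f^[n] x) (f^[n] y)) :=
    isBoundedUnder_of ⟨0, fun n => dist_nonneg⟩
  constructor
  · refine lt_of_lt_of_le (by positivity : 0 < dist p q / 32) ?_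
    refine le_limsup_of_frequently_le ?_ hbd
    rw [frequently_atTop]
    intro N
    obtain ⟨n, hn, h'⟩ := (h N).2
    exact ⟨n, hn, h'.le⟩
  · apply le_antisymm
    · refine le_of_forall_pos_le_add fun ε hε => ?_
      rw [zero_add]
      refine liminf_le_of_frequently_le ?_ hbd'
      rw [frequently_atTop]
      intro N
      obtain ⟨K, hK⟩ := exists_nat_one_div_lt hε
      obtain ⟨n, hn, h'⟩ := (h (max N K)).1
      refine ⟨n, (le_max_left _ _).trans hn, (h'.le.trans ?_).trans hK.le⟩
      have : (K : ℝ) ≤ ((max N K : ℕ) : ℝ) := by exact_mod_cast le_max_right N K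
      gcongr
    · exact le_liminf_of_le hbd.isCoboundedUnder_ge (Eventually.of_forall fun n => dist_nonneg)
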